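/- Let p be a prime, A a commutative ring, m a natural number, and 𝒜 : ℕ → AddSubgroup A an internal grading of the additive group of A (the subgroups 𝒜 d are independent and every element of A is a finite sum of elements of the 𝒜 d, i.e. the family gives an internal direct sum decomposition of A) satisfying 𝒜 d₁ · 𝒜 d₂ ⊆ 𝒜 (d₁+d₂) for all d₁, d₂. For d ∈ ℕ let W_m^{(d)}(A) be the set of truncated Witt vectors x of length m+1 over p such that for every i with 0 ≤ i ≤ m: x.coeff (m−i) ∈ 𝒜 (d/p^i) whenever p^i divides d, and x.coeff (m−i) = 0 whenever p^i does not divide d. Then each W_m^{(d)}(A) is an additive subgroup of the truncated Witt vector ring W_m(A), the family (W_m^{(d)}(A))_{d∈ℕ} is an internal direct sum decomposition of the additive group of W_m(A), and W_m^{(d₁)}(A) · W_m^{(d₂)}(A) ⊆ W_m^{(d₁+d₂)}(A) for all d₁, d₂. -/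

import Mathlib

/-- The `d`-th graded piece `W_m^{(d)}(A)` of the truncated Witt vectors of a graded
ring `A = ⊕_d 𝒜_d`: the coefficient `x.coeff (m-i)` lies in `𝒜 (d / p^i)` when
`p^i ∣ d`, and vanishes otherwise. -/
def WittVectorGrPiece (p : ℕ) [hp : Fact p.Prime] {A : Type*} [CommRing A] (m : ℕ)
    (𝒜 : ℕ → AddSubgroup A) (d : ℕ) (x : TruncatedWittVector p (m + 1) A) : Prop :=
  ∀ i : ℕ, i ≤ m →
    if p ^ i ∣ d then
      x.coeff ⟨m - i, Nat.lt_succ_of_le (Nat.sub_le m i)⟩ ∈ 𝒜 (d / p ^ i)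
    else
      x.coeff ⟨m - i, Nat.lt_succ_of_le (Nat.sub_le m i)⟩ = 0

section WeightedHomogeneous

open MvPolynomial

/-- Evaluating a weighted homogeneous polynomial at homogeneous elements of matching degrees gives
a homogeneous element. -/
theorem MvPolynomial.IsWeightedHomogeneous.aeval_mem_graded {R A σ M : Type*} [CommSemiring R]
    [CommSemiring A] [Algebra R A] [AddCommMonoid M] (B : M → Submodule R A)
    [SetLike.GradedMonoid B] {w : σ → M} {φ : MvPolynomial σ R} {n : M}
    (hφ : IsWeightedHomogeneous w φ n) {f : σ → A} (hf : ∀ s, f s ∈ B (w s)) :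
    aeval f φ ∈ B n := by
  rw [aeval_def, eval₂_eq]
  refine Submodule.sum_mem _ fun d hd ↦ ?_
  rw [← Algebra.smul_def]
  refine Submodule.smul_mem _ _ ?_
  rw [← hφ (mem_support_iff.mp hd), Finsupp.weight_apply]
  exact SetLike.prod_pow_mem_graded B _ _ _ fun s _ ↦ hf s

theorem MvPolynomial.isWeightedHomogeneous_map_iff {R S σ M : Type*} [CommSemiring R]
    [CommSemiring S] [AddCommMonoid M] {g : R →+* S} (hg : Function.Injective g) {w : σ → M}
    {φ : MvPolynomial σ R} {n : M} :
    IsWeightedHomogeneous w (map g φ) n ↔ IsWeightedHomogeneous w φ n := by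
  simp only [IsWeightedHomogeneous, coeff_map, ne_eq, map_eq_zero_iff g hg]

/-- If `Φ` is weighted homogeneous of degree `c` for the weights `v`, then the `n`-th Witt
structure polynomial of `Φ` is weighted homogeneous of degree `c * p ^ n` when the variable
`(i, k)` has weight `v i * p ^ k`. -/
theorem isWeightedHomogeneous_wittStructureRat (p : ℕ) [Fact p.Prime] {idx : Type*}
    {Φ : MvPolynomial idx ℚ} {v : idx → ℕ} {c : ℕ} (hΦ : IsWeightedHomogeneous v Φ c) (n : ℕ) :
    IsWeightedHomogeneous (fun s : idx × ℕ ↦ v s.1 * p ^ s.2) (wittStructureRat p Φ n)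
      (c * p ^ n) := by
  set w : idx × ℕ → ℕ := fun s ↦ v s.1 * p ^ s.2
  induction n using Nat.strong_induction_on with
  | _ n ih =>
    have key (i : ℕ) (hi : i ≤ n) (d : ℕ) : p ^ (n - i) • (d * p ^ i) = d * p ^ n := by
      rw [smul_eq_mul, mul_left_comm, ← pow_add, Nat.sub_add_cancel hi]
    rw [wittStructureRat_rec]
    refine IsWeightedHomogeneous.C_mul (.sub ?_ ?_) _
    · have : SetLike.GradedMonoid
          fun d : ℕ ↦ weightedHomogeneousSubmodule ℚ w (d * p ^ n) :=
        { one_mem := by simpa using isWeightedHomogeneous_one ℚ w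
          mul_mem := fun i j a b ha hb ↦ by
            rw [add_mul]
            exact IsWeightedHomogeneous.mul ha hb }
      refine hΦ.aeval_mem_graded (fun d : ℕ ↦ weightedHomogeneousSubmodule ℚ w (d * p ^ n))
        fun i ↦ ?_
      rw [mem_weightedHomogeneousSubmodule, wittPolynomial_eq_sum_C_mul_X_pow, map_sum]
      refine IsWeightedHomogeneous.sum _ _ _ fun k hk ↦ ?_
      rw [map_mul, rename_C, map_pow (rename _), rename_X,
        ← key k (by simpa [Nat.lt_succ_iff] using hk)]
      exact ((isWeightedHomogeneous_X ℚ w (i, k)).pow _).C_mul _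
    · refine IsWeightedHomogeneous.sum _ _ _ fun k hk ↦ ?_
      rw [Finset.mem_range] at hk
      rw [← key k hk.le]
      exact ((ih k hk).pow _).C_mul _

theorem isWeightedHomogeneous_wittStructureInt (p : ℕ) [Fact p.Prime] {idx : Type*}
    {Φ : MvPolynomial idx ℤ} {v : idx → ℕ} {c : ℕ} (hΦ : IsWeightedHomogeneous v Φ c) (n : ℕ) :
    IsWeightedHomogeneous (fun s : idx × ℕ ↦ v s.1 * p ^ s.2) (wittStructureInt p Φ n)
      (c * p ^ n) := by
  have hinj : Function.Injective (Int.castRingHom ℚ) := Int.cast_injective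
  rw [← isWeightedHomogeneous_map_iff hinj, map_wittStructureInt]
  exact isWeightedHomogeneous_wittStructureRat p ((isWeightedHomogeneous_map_iff hinj).mpr hΦ) n

end WeightedHomogeneous

namespace WittVector

open MvPolynomial

section GradedPart

variable {p : ℕ} [hp : Fact p.Prime] {A : Type*} [CommRing A]
variable (B : ℕ → AddSubgroup A) [SetLike.GradedMonoid B]

theorem eval_wittStructureInt_coeff_mem_graded {k : ℕ} {Φ : MvPolynomial (Fin k) ℤ}
    {v : Fin k → ℕ} {c : ℕ} (hΦ : IsWeightedHomogeneous v Φ c) {x : Fin k → ℕ → A}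
    (hx : ∀ i j, x i j ∈ B (v i * p ^ j)) (n : ℕ) :
    peval (wittStructureInt p Φ n) x ∈ B (c * p ^ n) := by
  have : SetLike.GradedMonoid fun d ↦ (B d).toIntSubmodule :=
    { one_mem := SetLike.GradedOne.one_mem (A := B)
      mul_mem := fun _ _ _ _ ha hb ↦ SetLike.GradedMul.mul_mem (A := B) ha hb }
  exact (isWeightedHomogeneous_wittStructureInt p hΦ n).aeval_mem_graded
    (fun d ↦ (B d).toIntSubmodule) fun s ↦ hx s.1 s.2

/-- The Witt vectors whose `k`-th coefficient is homogeneous of degree `d * p ^ k` for all `k`. -/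
def gradedPart (d : ℕ) : AddSubgroup (WittVector p A) where
  carrier := {x | ∀ k, x.coeff k ∈ B (d * p ^ k)}
  zero_mem' k := by simp
  add_mem' {x y} hx hy n := by
    rw [add_coeff]
    refine eval_wittStructureInt_coeff_mem_graded B (v := fun _ ↦ d)
      ((isWeightedHomogeneous_X ℤ _ 0).add (isWeightedHomogeneous_X ℤ _ 1)) (fun i ↦ ?_) n
    fin_cases i
    exacts [hx, hy]
  neg_mem' {x} hx n := by
    rw [neg_coeff]
    refine eval_wittStructureInt_coeff_mem_graded B (v := fun _ ↦ d)
      (isWeightedHomogeneous_X ℤ _ 0).neg (fun i ↦ ?_) n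
    fin_cases i
    exact hx

variable {B}

theorem mem_gradedPart {d : ℕ} {x : WittVector p A} :
    x ∈ gradedPart B d ↔ ∀ k, x.coeff k ∈ B (d * p ^ k) :=
  Iff.rfl

theorem mul_mem_gradedPart {d₁ d₂ : ℕ} {x y : WittVector p A} (hx : x ∈ gradedPart B d₁)
    (hy : y ∈ gradedPart B d₂) : x * y ∈ gradedPart B (d₁ + d₂) := fun n ↦ by
  rw [mul_coeff]
  refine eval_wittStructureInt_coeff_mem_graded B (v := ![d₁, d₂])
    ((isWeightedHomogeneous_X ℤ _ 0).mul (isWeightedHomogeneous_X ℤ _ 1)) (fun i ↦ ?_) n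
  fin_cases i
  exacts [hx, hy]

theorem iterate_verschiebung_teichmuller_mem_gradedPart {a : A} {d k : ℕ}
    (ha : a ∈ B (d * p ^ k)) : verschiebung^[k] (teichmuller p a) ∈ gradedPart B d := fun n ↦ by
  obtain h | ⟨j, rfl⟩ := (lt_or_ge n k).imp_right Nat.exists_eq_add_of_le'
  · rw [iterate_verschiebung_coeff_eq_zero _ h]
    exact zero_mem _
  · rw [iterate_verschiebung_coeff]
    obtain rfl | hj := j.eq_zero_or_pos
    · simpa using ha
    · rw [teichmuller_coeff_pos _ _ _ hj]
      exact zero_mem _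

variable (B) in
/-- The truncated Witt vectors of length `n` whose `k`-th coefficient is homogeneous of degree
`d * p ^ k` for all `k < n`. -/
noncomputable def truncatedGradedPart (n d : ℕ) : AddSubgroup (TruncatedWittVector p n A) :=
  (gradedPart B d).map (truncate n : WittVector p A →+* _).toAddMonoidHom

theorem truncate_mem_truncatedGradedPart {n d : ℕ} {x : WittVector p A}
    (hx : x ∈ gradedPart B d) : truncate n x ∈ truncatedGradedPart B n d :=
  ⟨x, hx, rfl⟩

theorem mem_truncatedGradedPart {n d : ℕ} {x : TruncatedWittVector p n A} :
    x ∈ truncatedGradedPart B n d ↔ ∀ k : Fin n, x.coeff k ∈ B (d * p ^ (k : ℕ)) := by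
  constructor
  · rintro ⟨y, hy, rfl⟩ k
    exact (coeff_truncate y k).symm ▸ hy k
  · intro hx
    refine ⟨x.out, fun k ↦ ?_, x.truncateFun_out⟩
    by_cases hk : k < n
    · exact (x.coeff_out ⟨k, hk⟩).symm ▸ hx ⟨k, hk⟩
    · simp [TruncatedWittVector.out, hk]

theorem mul_mem_truncatedGradedPart {n d₁ d₂ : ℕ} {x y : TruncatedWittVector p n A}
    (hx : x ∈ truncatedGradedPart B n d₁) (hy : y ∈ truncatedGradedPart B n d₂) :
    x * y ∈ truncatedGradedPart B n (d₁ + d₂) := by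
  obtain ⟨x, hx, rfl⟩ := hx
  obtain ⟨y, hy, rfl⟩ := hy
  exact ⟨x * y, mul_mem_gradedPart hx hy, map_mul (truncate n) x y⟩

end GradedPart

section Coeff

variable {p : ℕ} [hp : Fact p.Prime] {A : Type*} [CommRing A]

/-- The first possibly nonzero coefficient is additive. -/
theorem coeff_sum_of_forall_lt_eq_zero {ι : Type*} (s : Finset ι) (x : ι → WittVector p A) {k : ℕ}
    (hx : ∀ d ∈ s, ∀ j < k, (x d).coeff j = 0) :
    (∑ d ∈ s, x d).coeff k = ∑ d ∈ s, (x d).coeff k := by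
  let V : AddMonoid.End (WittVector p A) := verschiebung
  have hV (y : WittVector p A) : (V ^ k) y = verschiebung^[k] y :=
    congrFun (AddMonoid.End.coe_pow _ V k) y
  have h : ∑ d ∈ s, x d = verschiebung^[k] (∑ d ∈ s, (x d).shift k) := by
    rw [← hV, map_sum]
    exact Finset.sum_congr rfl fun d hd ↦ by rw [hV, ← eq_iterate_verschiebung (hx d hd)]
  have hcoeff := iterate_verschiebung_coeff (∑ d ∈ s, (x d).shift k) k 0
  rw [Nat.zero_add] at hcoeff
  rw [h, hcoeff]
  exact (map_sum (constantCoeff (p := p) (R := A)) _ s).trans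
    (Finset.sum_congr rfl fun d _ ↦ by simp [constantCoeff, shift_coeff])

theorem _root_.TruncatedWittVector.coeff_sum_of_forall_lt_eq_zero {ι : Type*} {n : ℕ}
    (s : Finset ι) (x : ι → TruncatedWittVector p n A) {k : Fin n}
    (hx : ∀ d ∈ s, ∀ j < k, (x d).coeff j = 0) :
    (∑ d ∈ s, x d).coeff k = ∑ d ∈ s, (x d).coeff k := by
  have h : ∑ d ∈ s, x d = truncate n (∑ d ∈ s, (x d).out) := by
    rw [map_sum]
    exact Finset.sum_congr rfl fun d _ ↦ (x d).truncateFun_out.symm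
  rw [h, coeff_truncate, WittVector.coeff_sum_of_forall_lt_eq_zero]
  · simp
  · intro d hd j hj
    simpa using ((x d).coeff_out ⟨j, hj.trans k.2⟩).trans (hx d hd ⟨j, _⟩ hj)

/-- A subgroup of the truncated Witt vectors is everything as soon as it contains, for every `a`
and `k`, a vector of the form `(0, …, 0, a, *, …, *)` with `a` in position `k`. -/
theorem eq_top_of_exists_iterate_verschiebung {n : ℕ} (S : AddSubgroup (TruncatedWittVector p n A))
    (hS : ∀ k < n, ∀ a : A, ∃ y : WittVector p A,
      y.coeff 0 = a ∧ truncate n (verschiebung^[k] y) ∈ S) : S = ⊤ := by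
  have key (k : ℕ) (hk : k ≤ n) : ∀ x : WittVector p A, truncate n (verschiebung^[k] x) ∈ S := by
    induction hk using Nat.decreasingInduction with
    | self =>
      intro x
      have : truncate n (verschiebung^[n] x) = 0 := by
        ext i
        rw [coeff_truncate, iterate_verschiebung_coeff_eq_zero _ i.2, TruncatedWittVector.coeff_zero]
      exact this ▸ zero_mem S
    | of_succ k hk ih =>
      intro x
      obtain ⟨y, hy, hyS⟩ := hS k hk (x.coeff 0)
      have h0 : ∀ i < 1, (x - y).coeff i = 0 := by
        intro i hi
        obtain rfl : i = 0 := by lia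
        exact (map_sub (constantCoeff (p := p) (R := A)) x y).trans (sub_eq_zero.mpr hy.symm)
      have hx : verschiebung^[k] x
          = verschiebung^[k] y + verschiebung^[k + 1] ((x - y).shift 1) := by
        rw [Function.iterate_add_apply, ← eq_iterate_verschiebung h0, ← iterate_map_add,
          add_sub_cancel]
      rw [hx, map_add]
      exact add_mem hyS (ih _)
  refine eq_top_iff.mpr fun x _ ↦ ?_
  obtain ⟨y, rfl⟩ := truncate_surjective p n A x
  exact key 0 n.zero_le y

end Coeff

end WittVector

section DilatedGrading

open DirectSum

variable {A : Type*} [CommRing A]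

/-- The unit of an internally graded ring has degree zero. -/
theorem DirectSum.IsInternal.one_mem_zero {𝒜 : ℕ → AddSubgroup A} (h : IsInternal 𝒜)
    (hmul : ∀ d₁ d₂ : ℕ, ∀ a b : A, a ∈ 𝒜 d₁ → b ∈ 𝒜 d₂ → a * b ∈ 𝒜 (d₁ + d₂)) :
    (1 : A) ∈ 𝒜 0 := by
  classical
  let _ := h.chooseDecomposition
  set e : A := (decompose 𝒜 (1 : A) 0 : A) with he
  have key (a : A) : a * e = a := by
    induction a using DirectSum.Decomposition.inductionOn 𝒜 with
    | zero => simp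
    | add a b ha hb => rw [add_mul, ha, hb]
    | @homogeneous i a =>
      have hdec (b : A) : (decompose 𝒜 ((a : A) * b) i : A) = a * decompose 𝒜 b 0 := by
        induction b using DirectSum.Decomposition.inductionOn 𝒜 with
        | zero => simp
        | add b c hb hc => simp [mul_add, hb, hc]
        | @homogeneous j b =>
          obtain rfl | hj := eq_or_ne j 0
          · rw [decompose_of_mem_same 𝒜 b.2]
            exact decompose_of_mem_same 𝒜 (hmul i 0 _ _ a.2 b.2)
          · rw [decompose_of_mem_ne 𝒜 b.2 hj, mul_zero]
            exact decompose_of_mem_ne 𝒜 (hmul i j _ _ a.2 b.2) (by lia)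
      rw [he, ← hdec, mul_one, decompose_of_mem_same 𝒜 a.2]
  rw [← key 1, one_mul, he]
  exact SetLike.coe_mem _

/-- The grading obtained from `𝒜` by multiplying all degrees by `q`. -/
def dilatedGrading (q : ℕ) (𝒜 : ℕ → AddSubgroup A) (n : ℕ) : AddSubgroup A :=
  if q ∣ n then 𝒜 (n / q) else ⊥

theorem dilatedGrading_mul {q : ℕ} (hq : 0 < q) (𝒜 : ℕ → AddSubgroup A) (n : ℕ) :
    dilatedGrading q 𝒜 (q * n) = 𝒜 n := by
  rw [dilatedGrading, if_pos (Nat.dvd_mul_right q n), Nat.mul_div_cancel_left n hq]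

theorem eq_zero_of_mem_dilatedGrading {q : ℕ} {𝒜 : ℕ → AddSubgroup A} {n : ℕ} {a : A}
    (ha : a ∈ dilatedGrading q 𝒜 n) (h : ¬q ∣ n) : a = 0 := by
  rwa [dilatedGrading, if_neg h, AddSubgroup.mem_bot] at ha

theorem gradedMonoid_dilatedGrading {q : ℕ} (hq : 0 < q) {𝒜 : ℕ → AddSubgroup A}
    (hone : (1 : A) ∈ 𝒜 0)
    (hmul : ∀ d₁ d₂ : ℕ, ∀ a b : A, a ∈ 𝒜 d₁ → b ∈ 𝒜 d₂ → a * b ∈ 𝒜 (d₁ + d₂)) :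
    SetLike.GradedMonoid (dilatedGrading q 𝒜) where
  one_mem := by simpa [dilatedGrading] using hone
  mul_mem i j a b ha hb := by
    by_cases hi : q ∣ i
    · by_cases hj : q ∣ j
      · obtain ⟨i, rfl⟩ := hi
        obtain ⟨j, rfl⟩ := hj
        rw [dilatedGrading_mul hq] at ha hb
        rw [← mul_add, dilatedGrading_mul hq]
        exact hmul i j a b ha hb
      · rw [eq_zero_of_mem_dilatedGrading hb hj, mul_zero]
        exact zero_mem _
    · rw [eq_zero_of_mem_dilatedGrading ha hi, zero_mul]
      exact zero_mem _

/-- Elements of distinct degrees in a dilated grading are independent. -/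
theorem DirectSum.IsInternal.eq_zero_of_sum_eq_zero {𝒜 : ℕ → AddSubgroup A} (h : IsInternal 𝒜)
    {q : ℕ} (hq : 0 < q) {ι : Type*} {s : Finset ι} {g : ι → ℕ} (hg : Function.Injective g)
    {a : ι → A} (ha : ∀ d ∈ s, a d ∈ dilatedGrading q 𝒜 (g d)) (hsum : ∑ d ∈ s, a d = 0) :
    ∀ d ∈ s, a d = 0 := by
  classical
  let _ := h.chooseDecomposition
  intro d hd
  by_cases hqd : q ∣ g d
  · obtain ⟨e, he⟩ := hqd
    have hmem : a d ∈ 𝒜 e := by simpa only [he, dilatedGrading_mul hq] using ha d hd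
    have hproj : ∑ d' ∈ s, (decompose 𝒜 (a d') e : A) = 0 := by
      rw [← AddSubmonoidClass.coe_finsetSum, ← DirectSum.sum_apply, ← decompose_sum, hsum]
      simp
    rwa [Finset.sum_eq_single_of_mem d hd, decompose_of_mem_same 𝒜 hmem] at hproj
    intro d' hd' hne
    by_cases hqd' : q ∣ g d'
    · obtain ⟨e', he'⟩ := hqd'
      refine decompose_of_mem_ne 𝒜 (i := e')
        (by simpa only [he', dilatedGrading_mul hq] using ha d' hd') ?_
      rintro rfl
      exact hne (hg (he'.trans he.symm))
    · simp [eq_zero_of_mem_dilatedGrading (ha d' hd') hqd']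
  · exact eq_zero_of_mem_dilatedGrading (ha d hd) hqd

end DilatedGrading

namespace WittVector

variable {p : ℕ} [hp : Fact p.Prime] {A : Type*} [CommRing A]

theorem mem_truncatedGradedPart_dilatedGrading {m : ℕ} {𝒜 : ℕ → AddSubgroup A}
    [SetLike.GradedMonoid (dilatedGrading (p ^ m) 𝒜)] {d : ℕ}
    {x : TruncatedWittVector p (m + 1) A} :
    x ∈ truncatedGradedPart (dilatedGrading (p ^ m) 𝒜) (m + 1) d ↔
      WittVectorGrPiece p m 𝒜 d x := by
  have hpos (i : ℕ) : 0 < p ^ i := pow_pos hp.out.pos i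
  have hB (i : ℕ) (hi : i ≤ m) : dilatedGrading (p ^ m) 𝒜 (d * p ^ (m - i)) =
      if p ^ i ∣ d then 𝒜 (d / p ^ i) else ⊥ := by
    have hpm : p ^ m = p ^ i * p ^ (m - i) := by rw [← pow_add, Nat.add_sub_cancel' hi]
    simp only [dilatedGrading, hpm, Nat.mul_dvd_mul_iff_right (hpos _),
      Nat.mul_div_mul_right _ _ (hpos _)]
  rw [mem_truncatedGradedPart]
  constructor
  · intro h i hi
    have := h ⟨m - i, Nat.lt_succ_of_le (Nat.sub_le m i)⟩
    rw [hB i hi] at this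
    split_ifs with hd <;> simpa [hd] using this
  · rintro h ⟨k, hk⟩
    have hkm : m - (m - k) = k := by lia
    have := h (m - k) (Nat.sub_le m k)
    simp only [hkm] at this
    have hBk := hB (m - k) (Nat.sub_le m k)
    rw [hkm] at hBk
    simp only [hBk]
    split_ifs with hd <;> simpa [hd] using this

theorem isInternal_truncatedGradedPart {m : ℕ} {𝒜 : ℕ → AddSubgroup A}
    [SetLike.GradedMonoid (dilatedGrading (p ^ m) 𝒜)] (h : DirectSum.IsInternal 𝒜) :
    DirectSum.IsInternal fun d ↦
      truncatedGradedPart (p := p) (dilatedGrading (p ^ m) 𝒜) (m + 1) d := by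
  classical
  have hpos (i : ℕ) : 0 < p ^ i := pow_pos hp.out.pos i
  set W := fun d ↦ truncatedGradedPart (p := p) (dilatedGrading (p ^ m) 𝒜) (m + 1) d
  constructor
  · rw [injective_iff_map_eq_zero]
    intro f hf
    rw [DirectSum.coeAddMonoidHom_eq_dfinsuppSum, DFinsupp.sum] at hf
    have key (k : Fin (m + 1)) : ∀ d ∈ f.support, (f d : TruncatedWittVector p _ A).coeff k = 0 := by
      induction k using WellFoundedLT.induction with
      | ind k ih =>
        refine h.eq_zero_of_sum_eq_zero (hpos m) (g := fun d ↦ d * p ^ (k : ℕ))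
          (fun a b hab ↦ Nat.eq_of_mul_eq_mul_right (hpos k) hab)
          (fun d _ ↦ mem_truncatedGradedPart.mp (f d).2 k) ?_
        rw [← TruncatedWittVector.coeff_sum_of_forall_lt_eq_zero _ _ fun d hd j hj ↦ ih j hj d hd,
          hf, TruncatedWittVector.coeff_zero]
    refine DFinsupp.support_eq_empty.mp (Finset.eq_empty_of_forall_notMem fun d hd ↦ ?_)
    refine DFinsupp.mem_support_iff.mp hd (Subtype.ext (TruncatedWittVector.ext fun k ↦ ?_))
    rw [key k d hd, ZeroMemClass.coe_zero, TruncatedWittVector.coeff_zero]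
  · rw [← AddMonoidHom.range_eq_top]
    have hle {d : ℕ} {x : TruncatedWittVector p (m + 1) A} (hx : x ∈ W d) :
        x ∈ (DirectSum.coeAddMonoidHom W).range :=
      ⟨DirectSum.of (fun d ↦ W d) d ⟨x, hx⟩, DirectSum.coeAddMonoidHom_of W d ⟨x, hx⟩⟩
    refine eq_top_of_exists_iterate_verschiebung _ fun k hk a ↦ ?_
    let _ := h.chooseDecomposition
    induction a using DirectSum.Decomposition.inductionOn 𝒜 with
    | zero => exact ⟨0, zero_coeff p A 0, by simp [iterate_map_zero]⟩
    | add a b ha hb =>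
      obtain ⟨y, rfl, hy⟩ := ha
      obtain ⟨z, rfl, hz⟩ := hb
      refine ⟨y + z, add_coeff_zero y z, ?_⟩
      rw [iterate_map_add, map_add]
      exact add_mem hy hz
    | @homogeneous e a =>
      refine ⟨teichmuller p (a : A), teichmuller_coeff_zero p _,
        hle (d := e * p ^ (m - k)) (truncate_mem_truncatedGradedPart
          (iterate_verschiebung_teichmuller_mem_gradedPart ?_))⟩
      rw [mul_assoc, ← pow_add, Nat.sub_add_cancel (Nat.le_of_lt_succ hk), mul_comm,
        dilatedGrading_mul (hpos m)]
      exact a.2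

end WittVector

/-- If `A = ⊕_{d≥0} 𝒜_d` is an internally graded commutative ring
(with `𝒜 d₁ · 𝒜 d₂ ⊆ 𝒜 (d₁+d₂)`), then the pieces `W_m^{(d)}(A)` are additive
subgroups of `W_m(A)`, they give an internal direct sum decomposition of the
additive group of `W_m(A)`, and they are multiplicative:
`W_m^{(d₁)}(A) · W_m^{(d₂)}(A) ⊆ W_m^{(d₁+d₂)}(A)`. -/
theorem wittVector_of_graded_is_graded (p : ℕ) [hp : Fact p.Prime]
    {A : Type*} [CommRing A] (m : ℕ) (𝒜 : ℕ → AddSubgroup A)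
    (hinternal : DirectSum.IsInternal 𝒜)
    (hmul : ∀ d₁ d₂ : ℕ, ∀ a b : A, a ∈ 𝒜 d₁ → b ∈ 𝒜 d₂ → a * b ∈ 𝒜 (d₁ + d₂)) :
    ∃ W : ℕ → AddSubgroup (TruncatedWittVector p (m + 1) A),
      (∀ d : ℕ, (W d : Set (TruncatedWittVector p (m + 1) A)) =
        {x | WittVectorGrPiece p m 𝒜 d x}) ∧
      DirectSum.IsInternal W ∧
      (∀ d₁ d₂ : ℕ, ∀ x y : TruncatedWittVector p (m + 1) A,
        x ∈ W d₁ → y ∈ W d₂ → x * y ∈ W (d₁ + d₂)) := by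
  have hgraded := gradedMonoid_dilatedGrading (pow_pos hp.out.pos m)
    (hinternal.one_mem_zero hmul) hmul
  exact ⟨WittVector.truncatedGradedPart (dilatedGrading (p ^ m) 𝒜) (m + 1),
    fun d ↦ Set.ext fun x ↦ WittVector.mem_truncatedGradedPart_dilatedGrading,
    WittVector.isInternal_truncatedGradedPart hinternal,
    fun d₁ d₂ x y hx hy ↦ WittVector.mul_mem_truncatedGradedPart hx hy⟩
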